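/- arXiv:1302.4428 — 4 statements merged into one kernel-verified Lean document; each statement's English description precedes it below -/
import Mathlib

section
/- Let M = {(x,y,z) ∈ ℝ³ : x ≠ 0} with the frame E1(x,y,z) = (0, 2/x, 0), E2(x,y,z) = (2, −4z/x, xy), E3(x,y,z) = (0, 0, 1). Let D be any map assigning to each pair of smooth vector fields X, Y on M a smooth vector field D(X,Y), which is additive in each argument, C^∞(M)-linear in the first argument (D(fX, Y) = f·D(X,Y)), and satisfies the Leibniz rule in the second argument (D(X, fY) = (Xf)·Y + f·D(X,Y)). Suppose D satisfies the table: D(E1,E3) = 0, D(E2,E3) = 2E1, D(E3,E3) = 0, D(E1,E2) = (2/x)E1, D(E2,E1) = −2E3, D(E2,E2) = 0, D(E3,E2) = 0, D(E1,E1) = −(2/x)E2. Then the curvature expression R(E1,E2)E3 := D(E1, D(E2,E3)) − D(E2, D(E1,E3)) − D([E1,E2], E3) equals −(4/x)·E2, which is nonzero at every point of M. In particular R(E1,E2)E3 ≠ 0, so D cannot satisfy the N(k)-identity R(E1,E2)E3 = k(η(E2)E1 − η(E1)E2) = 0 (where η(E1) = η(E2) = 0) for any real constant k. -/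
/-- The vector field `E1 = (2/x) ∂/∂y` on `M = {(x,y,z) : x ≠ 0} ⊆ ℝ³`. -/
noncomputable def E1 : ℝ × ℝ × ℝ → ℝ × ℝ × ℝ := fun p => (0, 2 / p.1, 0)

/-- The vector field `E2 = 2 ∂/∂x − (4z/x) ∂/∂y + xy ∂/∂z`. -/
noncomputable def E2 : ℝ × ℝ × ℝ → ℝ × ℝ × ℝ := fun p => (2, -(4 * p.2.2) / p.1, p.1 * p.2.1)

/-- The vector field `E3 = ∂/∂z`. -/
def E3 : ℝ × ℝ × ℝ → ℝ × ℝ × ℝ := fun _ => (0, 0, 1)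

/-- Lie bracket of vector fields on (an open subset of) ℝ³:
`[X,Y](p) = DY(p)(X(p)) − DX(p)(Y(p))`. -/
noncomputable def lieBracket (X Y : ℝ × ℝ × ℝ → ℝ × ℝ × ℝ) (p : ℝ × ℝ × ℝ) : ℝ × ℝ × ℝ :=
  fderiv ℝ Y p (X p) - fderiv ℝ X p (Y p)

/-- The open set `M = {(x,y,z) ∈ ℝ³ : x ≠ 0}`. -/
def Mset : Set (ℝ × ℝ × ℝ) := {p | p.1 ≠ 0}

/-- A smooth vector field on `M`: a map smooth on `M` (vector fields on `M` are maps `M → ℝ³`). -/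
def SmoothVF (X : ℝ × ℝ × ℝ → ℝ × ℝ × ℝ) : Prop := ContDiffOn ℝ (⊤ : ℕ∞) X Mset

/-- A smooth function on `M`. -/
def SmoothF (f : ℝ × ℝ × ℝ → ℝ) : Prop := ContDiffOn ℝ (⊤ : ℕ∞) f Mset

theorem SmoothF.smul {f : ℝ × ℝ × ℝ → ℝ} {X : ℝ × ℝ × ℝ → ℝ × ℝ × ℝ}
    (hf : SmoothF f) (hX : SmoothVF X) : SmoothVF fun q => f q • X q :=
  ContDiffOn.smul hf hX

theorem smoothF_const (c : ℝ) : SmoothF fun _ => c := contDiffOn_const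

theorem smoothF_two_div : SmoothF fun p => 2 / p.1 :=
  contDiffOn_const.div contDiff_fst.contDiffOn fun _ hp => hp

theorem smoothVF_E1 : SmoothVF E1 :=
  contDiffOn_const.prodMk (smoothF_two_div.prodMk contDiffOn_const)

theorem smoothVF_E2 : SmoothVF E2 := by
  refine contDiffOn_const.prodMk (ContDiffOn.prodMk (ContDiffOn.div ?_ ?_ fun _ hp => hp) ?_)
  all_goals exact ContDiff.contDiffOn (by fun_prop)

theorem smoothVF_E3 : SmoothVF E3 := contDiffOn_const

theorem lieBracket_E1_E2 {p : ℝ × ℝ × ℝ} (hp : p ∈ Mset) :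
    lieBracket E1 E2 p = (2 / p.1) • E1 p + (2 : ℝ) • E3 p := by
  have hx : p.1 ≠ 0 := hp
  have hfst : HasFDerivAt (𝕜 := ℝ) (fun q : ℝ × ℝ × ℝ => q.1) _ p := hasFDerivAt_fst
  have hsnd : HasFDerivAt (𝕜 := ℝ) (fun q : ℝ × ℝ × ℝ => q.2) _ p := hasFDerivAt_snd
  have hinv := (hasDerivAt_inv hx).comp_hasFDerivAt p hfst
  have h1 : HasFDerivAt E1 _ p :=
    (hasFDerivAt_const (0 : ℝ) p).prodMk ((hinv.const_mul 2).prodMk (hasFDerivAt_const (0 : ℝ) p))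
  have h2 : HasFDerivAt E2 _ p :=
    (hasFDerivAt_const (2 : ℝ) p).prodMk
      (((hsnd.snd.const_mul 4).neg.mul hinv).prodMk (hfst.mul hsnd.fst))
  rw [lieBracket, h1.fderiv, h2.fderiv]
  ext
  · simp [E1, E2, E3]
  · simp [E1, E2, E3]
    field_simp
  · simp [E1, E2, E3]
    field_simp

theorem smoothVF_lieBracket_E1_E2 : SmoothVF (lieBracket E1 E2) :=
  ((smoothF_two_div.smul smoothVF_E1).add ((smoothF_const 2).smul smoothVF_E3)).congr
    fun _ hp => lieBracket_E1_E2 hp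

theorem E2_ne_zero (p : ℝ × ℝ × ℝ) : E2 p ≠ 0 := fun h => by
  simpa [E2] using congrArg Prod.fst h

/-- Let `D` assign to each pair of smooth vector fields on `M` a smooth vector field, additive in
each argument, `C^∞(M)`-linear in the first argument, satisfying the Leibniz rule in the second
argument (and, since vector fields on `M` are maps `M → ℝ³`, depending only on the values of its
arguments on `M`).  If `D` satisfies the stated table on the frame `E1, E2, E3`, then the
curvature expression `R(E1,E2)E3 = D(E1, D(E2,E3)) − D(E2, D(E1,E3)) − D([E1,E2], E3)` equals
`−(4/x)·E2`, which is nonzero at every point of `M`; in particular `D` cannot satisfy the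
`N(k)`-identity `R(E1,E2)E3 = k(η(E2)E1 − η(E1)E2)` (with `η(E1) = η(E2) = 0`) for any `k ∈ ℝ`. -/
theorem stmt_4
    (D : (ℝ × ℝ × ℝ → ℝ × ℝ × ℝ) → (ℝ × ℝ × ℝ → ℝ × ℝ × ℝ) → (ℝ × ℝ × ℝ → ℝ × ℝ × ℝ))
    (hsmooth : ∀ X Y, SmoothVF X → SmoothVF Y → SmoothVF (D X Y))
    (hadd1 : ∀ X X' Y, SmoothVF X → SmoothVF X' → SmoothVF Y →
      ∀ p ∈ Mset, D (fun q => X q + X' q) Y p = D X Y p + D X' Y p)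
    (hadd2 : ∀ X Y Y', SmoothVF X → SmoothVF Y → SmoothVF Y' →
      ∀ p ∈ Mset, D X (fun q => Y q + Y' q) p = D X Y p + D X Y' p)
    (hlin1 : ∀ f X Y, SmoothF f → SmoothVF X → SmoothVF Y →
      ∀ p ∈ Mset, D (fun q => f q • X q) Y p = f p • D X Y p)
    (hleib2 : ∀ f X Y, SmoothF f → SmoothVF X → SmoothVF Y →
      ∀ p ∈ Mset, D X (fun q => f q • Y q) p = (fderiv ℝ f p (X p)) • Y p + f p • D X Y p)
    (hloc1 : ∀ X X' Y, SmoothVF X → SmoothVF X' → SmoothVF Y →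
      (∀ p ∈ Mset, X p = X' p) → ∀ p ∈ Mset, D X Y p = D X' Y p)
    (hloc2 : ∀ X Y Y', SmoothVF X → SmoothVF Y → SmoothVF Y' →
      (∀ p ∈ Mset, Y p = Y' p) → ∀ p ∈ Mset, D X Y p = D X Y' p)
    (ht13 : ∀ p ∈ Mset, D E1 E3 p = 0)
    (ht23 : ∀ p ∈ Mset, D E2 E3 p = (2 : ℝ) • E1 p)
    (ht33 : ∀ p ∈ Mset, D E3 E3 p = 0)
    (ht12 : ∀ p ∈ Mset, D E1 E2 p = (2 / p.1) • E1 p)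
    (ht21 : ∀ p ∈ Mset, D E2 E1 p = (-2 : ℝ) • E3 p)
    (ht22 : ∀ p ∈ Mset, D E2 E2 p = 0)
    (ht32 : ∀ p ∈ Mset, D E3 E2 p = 0)
    (ht11 : ∀ p ∈ Mset, D E1 E1 p = (-(2 / p.1)) • E2 p) :
    (∀ p ∈ Mset,
      D E1 (D E2 E3) p - D E2 (D E1 E3) p - D (lieBracket E1 E2) E3 p
          = (-(4 / p.1)) • E2 p ∧
      D E1 (D E2 E3) p - D E2 (D E1 E3) p - D (lieBracket E1 E2) E3 p ≠ 0) ∧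
    ¬ ∃ k : ℝ, ∀ p ∈ Mset,
      D E1 (D E2 E3) p - D E2 (D E1 E3) p - D (lieBracket E1 E2) E3 p
        = k • ((0 : ℝ) • E1 p - (0 : ℝ) • E2 p) := by
  have hDD1 : ∀ p ∈ Mset, D E1 (D E2 E3) p = (-(4 / p.1)) • E2 p := fun p hp => by
    rw [hloc2 E1 _ (fun q => (2 : ℝ) • E1 q) smoothVF_E1
      (hsmooth _ _ smoothVF_E2 smoothVF_E3) ((smoothF_const _).smul smoothVF_E1) ht23 p hp,
      hleib2 (fun _ => 2) E1 E1 contDiffOn_const smoothVF_E1 smoothVF_E1 p hp, ht11 p hp,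
      smul_smul]
    simp only [fderiv_fun_const, Pi.zero_apply, zero_apply, zero_smul, zero_add]
    congr 1
    ring
  have hDD2 : ∀ p ∈ Mset, D E2 (D E1 E3) p = 0 := fun p hp => by
    rw [hloc2 E2 _ (fun q => (0 : ℝ) • E1 q) smoothVF_E2
      (hsmooth _ _ smoothVF_E1 smoothVF_E3) ((smoothF_const _).smul smoothVF_E1)
      (fun q hq => by rw [ht13 q hq, zero_smul]) p hp,
      hleib2 (fun _ => 0) E2 E1 contDiffOn_const smoothVF_E2 smoothVF_E1 p hp]
    simp
  have hDbracket : ∀ p ∈ Mset, D (lieBracket E1 E2) E3 p = 0 := fun p hp => by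
    have hs1 : SmoothVF fun q => (2 / q.1) • E1 q := smoothF_two_div.smul smoothVF_E1
    have hs3 : SmoothVF fun q => (2 : ℝ) • E3 q := (smoothF_const 2).smul smoothVF_E3
    rw [hloc1 _ (fun q => (2 / q.1) • E1 q + (2 : ℝ) • E3 q) E3 smoothVF_lieBracket_E1_E2
      (hs1.add hs3) smoothVF_E3 (fun _ hq => lieBracket_E1_E2 hq) p hp,
      hadd1 _ _ E3 hs1 hs3 smoothVF_E3 p hp,
      hlin1 (fun q => 2 / q.1) E1 E3 smoothF_two_div smoothVF_E1 smoothVF_E3 p hp,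
      hlin1 (fun _ => 2) E3 E3 contDiffOn_const smoothVF_E3 smoothVF_E3 p hp,
      ht13 p hp, ht33 p hp]
    simp
  have hcurv : ∀ p ∈ Mset,
      D E1 (D E2 E3) p - D E2 (D E1 E3) p - D (lieBracket E1 E2) E3 p
        = (-(4 / p.1)) • E2 p := fun p hp => by
    rw [hDD1 p hp, hDD2 p hp, hDbracket p hp, sub_zero, sub_zero]
  have hne : ∀ p ∈ Mset, (-(4 / p.1)) • E2 p ≠ 0 := fun p hp =>
    smul_ne_zero (neg_ne_zero.mpr (div_ne_zero four_ne_zero hp)) (E2_ne_zero p)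
  refine ⟨fun p hp => ⟨hcurv p hp, hcurv p hp ▸ hne p hp⟩, ?_⟩
  rintro ⟨k, hk⟩
  have hp : ((1, 0, 0) : ℝ × ℝ × ℝ) ∈ Mset := one_ne_zero
  refine hne _ hp ?_
  rw [← hcurv _ hp, hk _ hp]
  simp
end

section
/- Let M = {(x,y,z) ∈ ℝ³ : x ≠ 0} with the frame E1(x,y,z) = (0, 2/x, 0), E2(x,y,z) = (2, −4z/x, xy), E3(x,y,z) = (0, 0, 1). Define φ pointwise as the linear map φ_p : ℝ³ → ℝ³ determined by φ_p(E1(p)) = E2(p), φ_p(E2(p)) = −E1(p), φ_p(E3(p)) = 0, and for a vector field X set (φX)(p) = φ_p(X(p)). Define h by hX = (1/2)·([E3, φX] − φ[E3, X]) (one half of the Lie derivative of φ along ξ = E3 applied to X). Then hE1 = −E1, hE2 = E2, and hE3 = 0 as vector fields on M. -/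
/-- The bracket with `E3` differentiates along `z`: if `X` is affine in `z` with slope `c`,
then `[E3, X] = c`. -/
lemma lieBracket_E3_eq_of_affine {X : ℝ × ℝ × ℝ → ℝ × ℝ × ℝ} {p c : ℝ × ℝ × ℝ}
    (hX : DifferentiableAt ℝ X p) (h : ∀ t : ℝ, X (p + t • (0, 0, 1)) = X p + t • c) :
    lieBracket E3 X p = c := by
  have hE3 : fderiv ℝ E3 p = 0 := fderiv_const_apply _
  have hderiv : HasDerivAt (fun t : ℝ => X p + t • c) c 0 := by
    simpa using ((hasDerivAt_id (0 : ℝ)).smul_const c).const_add (X p)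
  have hline : lineDeriv ℝ X p (0, 0, 1) = c := by
    simp only [lineDeriv, h, hderiv.deriv]
  simp only [lieBracket, hE3, E3, ← hX.lineDeriv_eq_fderiv, hline,
    zero_apply, sub_zero]

lemma differentiableAt_E1 {p : ℝ × ℝ × ℝ} (hp : p.1 ≠ 0) : DifferentiableAt ℝ E1 p := by
  unfold E1
  fun_prop (disch := assumption)

lemma differentiableAt_E2 {p : ℝ × ℝ × ℝ} (hp : p.1 ≠ 0) : DifferentiableAt ℝ E2 p := by
  unfold E2
  fun_prop (disch := assumption)

lemma lieBracket_E3_E1 {p : ℝ × ℝ × ℝ} (hp : p.1 ≠ 0) : lieBracket E3 E1 p = 0 :=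
  lieBracket_E3_eq_of_affine (differentiableAt_E1 hp) fun t => by simp [E1]

lemma lieBracket_E3_neg_E1 {p : ℝ × ℝ × ℝ} (hp : p.1 ≠ 0) : lieBracket E3 (-E1) p = 0 :=
  lieBracket_E3_eq_of_affine (differentiableAt_E1 hp).neg fun t => by simp [E1]

lemma lieBracket_E3_E2 {p : ℝ × ℝ × ℝ} (hp : p.1 ≠ 0) :
    lieBracket E3 E2 p = (-2 : ℝ) • E1 p :=
  lieBracket_E3_eq_of_affine (differentiableAt_E2 hp) fun t => by
    simp only [E1, E2, Prod.ext_iff, Prod.fst_add, Prod.snd_add, Prod.smul_fst, Prod.smul_snd,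
      smul_eq_mul]
    refine ⟨by ring, ?_, by ring⟩
    simp only [mul_zero, add_zero]
    ring

lemma lieBracket_E3_E3 (p : ℝ × ℝ × ℝ) : lieBracket E3 E3 p = 0 := sub_self _

lemma lieBracket_E3_zero (p : ℝ × ℝ × ℝ) : lieBracket E3 0 p = 0 :=
  lieBracket_E3_eq_of_affine (differentiableAt_const 0) fun t => by simp

/-- The bracket at `p ∈ M` depends only on the second field restricted to `M`. -/
lemma lieBracket_congr_of_eqOn {X Y Z : ℝ × ℝ × ℝ → ℝ × ℝ × ℝ}
    (h : ∀ q : ℝ × ℝ × ℝ, q.1 ≠ 0 → Y q = Z q) {p : ℝ × ℝ × ℝ} (hp : p.1 ≠ 0) :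
    lieBracket X Y p = lieBracket X Z p := by
  have hYZ : Y =ᶠ[nhds p] Z := (continuousAt_fst.eventually_ne hp).mono h
  simp only [lieBracket, hYZ.fderiv_eq, h p hp]

/-- With `φ` defined pointwise (for `p ∈ M`) as the linear map determined on the frame by
`φ_p(E1 p) = E2 p`, `φ_p(E2 p) = −E1 p`, `φ_p(E3 p) = 0`, and
`hX = (1/2)·([E3, φX] − φ[E3, X])` (one half of the Lie derivative of `φ` along `ξ = E3`),
one has `hE1 = −E1`, `hE2 = E2`, `hE3 = 0` on `M`. -/
theorem stmt_5 (φ : (ℝ × ℝ × ℝ) → (ℝ × ℝ × ℝ) →ₗ[ℝ] (ℝ × ℝ × ℝ))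
    (hφ1 : ∀ p : ℝ × ℝ × ℝ, p.1 ≠ 0 → φ p (E1 p) = E2 p)
    (hφ2 : ∀ p : ℝ × ℝ × ℝ, p.1 ≠ 0 → φ p (E2 p) = -E1 p)
    (hφ3 : ∀ p : ℝ × ℝ × ℝ, p.1 ≠ 0 → φ p (E3 p) = 0) :
    ∀ p : ℝ × ℝ × ℝ, p.1 ≠ 0 →
      ((1 : ℝ) / 2) • (lieBracket E3 (fun q => φ q (E1 q)) p - φ p (lieBracket E3 E1 p))
          = -E1 p ∧
      ((1 : ℝ) / 2) • (lieBracket E3 (fun q => φ q (E2 q)) p - φ p (lieBracket E3 E2 p))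
          = E2 p ∧
      ((1 : ℝ) / 2) • (lieBracket E3 (fun q => φ q (E3 q)) p - φ p (lieBracket E3 E3 p))
          = 0 := by
  intro p hp
  refine ⟨?_, ?_, ?_⟩
  · rw [lieBracket_congr_of_eqOn hφ1 hp, lieBracket_E3_E1 hp, lieBracket_E3_E2 hp, map_zero]
    module
  · rw [lieBracket_congr_of_eqOn (Z := -E1) hφ2 hp, lieBracket_E3_neg_E1 hp,
      lieBracket_E3_E2 hp, map_smul, hφ1 p hp]
    module
  · rw [lieBracket_congr_of_eqOn (Z := 0) hφ3 hp, lieBracket_E3_zero, lieBracket_E3_E3, map_zero]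
    module
end

section
/- Let (V, ⟨·,·⟩) be a 3-dimensional real inner product space, ξ ∈ V a unit vector, η(X) = ⟨X, ξ⟩, Q : V → V a symmetric linear operator, S(X,Y) = ⟨QX, Y⟩, r = tr Q, and k ∈ ℝ. Define R(X,Y)Z = ⟨Y,Z⟩QX − ⟨X,Z⟩QY + S(Y,Z)X − S(X,Z)Y + (r/2)(⟨X,Z⟩Y − ⟨Y,Z⟩X). If S(X, ξ) = 2k·η(X) for all X and R(X,Y)ξ = k(η(Y)X − η(X)Y) for all X, Y, then the Ricci operator is given by QX = (r/2 − k)X + (3k − r/2)η(X)ξ for all X ∈ V. -/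
open RealInnerProductSpace

/-- The curvature expression of a 3-dimensional Riemannian manifold, pointwise:
`R(X,Y)Z = ⟨Y,Z⟩QX − ⟨X,Z⟩QY + S(Y,Z)X − S(X,Z)Y + (r/2)(⟨X,Z⟩Y − ⟨Y,Z⟩X)`,
where `S(X,Y) = ⟨QX,Y⟩`. -/
noncomputable def R3 {V : Type*} [NormedAddCommGroup V] [InnerProductSpace ℝ V]
    (Q : V →ₗ[ℝ] V) (r : ℝ) (X Y Z : V) : V :=
  ⟪Y, Z⟫ • Q X - ⟪X, Z⟫ • Q Y + ⟪Q Y, Z⟫ • X - ⟪Q X, Z⟫ • Y +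
    (r / 2) • (⟪X, Z⟫ • Y - ⟪Y, Z⟫ • X)

/-- If `S(X,ξ) = 2k·η(X)` and `R(X,Y)ξ = k(η(Y)X − η(X)Y)`, then the Ricci operator is
`QX = (r/2 − k)X + (3k − r/2)η(X)ξ`, where `r = tr Q` and `η(X) = ⟨X,ξ⟩`. -/
theorem stmt_8 {V : Type*} [NormedAddCommGroup V] [InnerProductSpace ℝ V]
    (hdim : Module.finrank ℝ V = 3) (ξ : V) (hξ : ‖ξ‖ = 1)
    (Q : V →ₗ[ℝ] V) (hQ : ∀ X Y : V, ⟪Q X, Y⟫ = ⟪X, Q Y⟫) (k : ℝ)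
    (hS : ∀ X : V, ⟪Q X, ξ⟫ = 2 * k * ⟪X, ξ⟫)
    (hR : ∀ X Y : V, R3 Q (LinearMap.trace ℝ V Q) X Y ξ = k • (⟪Y, ξ⟫ • X - ⟪X, ξ⟫ • Y)) :
    ∀ X : V, Q X = (LinearMap.trace ℝ V Q / 2 - k) • X +
      ((3 * k - LinearMap.trace ℝ V Q / 2) * ⟪X, ξ⟫) • ξ := by
  intro X
  have hξξ : ⟪ξ, ξ⟫ = (1 : ℝ) := by rw [real_inner_self_eq_norm_sq, hξ, one_pow]
  have hQξ : Q ξ = (2 * k) • ξ := by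
    refine ext_inner_left ℝ fun Y => ?_
    rw [← hQ, hS, inner_smul_right]
  have h := hR X ξ
  rw [R3, hS, hS, hQξ, hξξ] at h
  linear_combination (norm := module) h
end

section
/- Let (V, ⟨·,·⟩) be a 3-dimensional real inner product space, ξ ∈ V a unit vector, η(X) = ⟨X, ξ⟩, Q : V → V a symmetric linear operator, S(X,Y) = ⟨QX, Y⟩, r = tr Q, and k ∈ ℝ. Define R(X,Y)Z = ⟨Y,Z⟩QX − ⟨X,Z⟩QY + S(Y,Z)X − S(X,Z)Y + (r/2)(⟨X,Z⟩Y − ⟨Y,Z⟩X). If S(X, ξ) = 2k·η(X) for all X and R(X,Y)ξ = k(η(Y)X − η(X)Y) for all X, Y, then for all X, Y, Z ∈ V: R(X,Y)Z = (3k − r/2)[⟨Y,Z⟩η(X)ξ − ⟨X,Z⟩η(Y)ξ + η(Y)η(Z)X − η(X)η(Z)Y] + (r/2 − 2k)[⟨Y,Z⟩X − ⟨X,Z⟩Y]. -/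
open RealInnerProductSpace

/-- An operator satisfying `S(X,ξ) = 2k·η(X)` and `R(X,Y)ξ = k(η(Y)X − η(X)Y)` is
`QX = (r/2 − k)X + (3k − r/2)η(X)ξ`. -/
theorem ricci_operator_eq {V : Type*} [NormedAddCommGroup V] [InnerProductSpace ℝ V]
    {ξ : V} (hξ : ‖ξ‖ = 1) {Q : V →ₗ[ℝ] V} (hQ : ∀ X Y : V, ⟪Q X, Y⟫ = ⟪X, Q Y⟫) {k r : ℝ}
    (hS : ∀ X : V, ⟪Q X, ξ⟫ = 2 * k * ⟪X, ξ⟫)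
    (hR : ∀ X Y : V, R3 Q r X Y ξ = k • (⟪Y, ξ⟫ • X - ⟪X, ξ⟫ • Y)) (X : V) :
    Q X = (r / 2 - k) • X + ((3 * k - r / 2) * ⟪X, ξ⟫) • ξ := by
  have hξξ : ⟪ξ, ξ⟫ = 1 := by rw [real_inner_self_eq_norm_sq, hξ, one_pow]
  have hQξ : Q ξ = (2 * k) • ξ := by
    refine ext_inner_left ℝ fun Y => ?_
    rw [← hQ, hS, inner_smul_right]
  have h := hR X ξ
  simp only [R3, hS, hQξ, real_inner_smul_left, hξξ] at h
  linear_combination (norm := module) h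

/-- If `S(X,ξ) = 2k·η(X)` and `R(X,Y)ξ = k(η(Y)X − η(X)Y)`, then for all `X, Y, Z`:
`R(X,Y)Z = (3k − r/2)[⟨Y,Z⟩η(X)ξ − ⟨X,Z⟩η(Y)ξ + η(Y)η(Z)X − η(X)η(Z)Y]
          + (r/2 − 2k)[⟨Y,Z⟩X − ⟨X,Z⟩Y]`, where `r = tr Q` and `η(X) = ⟨X,ξ⟩`. -/
theorem stmt_10 {V : Type*} [NormedAddCommGroup V] [InnerProductSpace ℝ V]
    (hdim : Module.finrank ℝ V = 3) (ξ : V) (hξ : ‖ξ‖ = 1)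
    (Q : V →ₗ[ℝ] V) (hQ : ∀ X Y : V, ⟪Q X, Y⟫ = ⟪X, Q Y⟫) (k : ℝ)
    (hS : ∀ X : V, ⟪Q X, ξ⟫ = 2 * k * ⟪X, ξ⟫)
    (hR : ∀ X Y : V, R3 Q (LinearMap.trace ℝ V Q) X Y ξ = k • (⟪Y, ξ⟫ • X - ⟪X, ξ⟫ • Y)) :
    ∀ X Y Z : V, R3 Q (LinearMap.trace ℝ V Q) X Y Z =
      (3 * k - LinearMap.trace ℝ V Q / 2) •
        ((⟪Y, Z⟫ * ⟪X, ξ⟫) • ξ - (⟪X, Z⟫ * ⟪Y, ξ⟫) • ξ +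
          (⟪Y, ξ⟫ * ⟪Z, ξ⟫) • X - (⟪X, ξ⟫ * ⟪Z, ξ⟫) • Y) +
      (LinearMap.trace ℝ V Q / 2 - 2 * k) • (⟪Y, Z⟫ • X - ⟪X, Z⟫ • Y) := by
  intro X Y Z
  simp only [R3, ricci_operator_eq hξ hQ hS hR X, ricci_operator_eq hξ hQ hS hR Y,
    inner_add_left, real_inner_smul_left, real_inner_comm Z ξ]
  module
end
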